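/- arXiv:1409.1825 — 6 statements merged into one kernel-verified Lean document; each statement's English description precedes it below -/
import Mathlib

section
/- Let β > −1, γ > 0, δ > 0 and let U : ℝ → ℝ be infinitely differentiable with all derivatives uniformly bounded by a common constant, i.e. sup over k ∈ ℕ of the supremum norm of U^(k) is finite. Then for every η ∈ ℝ the Erdélyi–Kober fractional integral admits the series representation I^{β,γ}_δ U(η) = Σ_{k=0}^∞ λ_k · U^(k)(η) · η^k / k!, where the series converges absolutely. -/
/-- The Erdélyi–Kober fractional integral
`I^{β,γ}_δ U(η) = (1/Γ(γ)) ∫_0^1 (1−z)^{γ−1} z^β U(η z^{1/δ}) dz`. -/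
noncomputable def erdelyiKober (β γ δ : ℝ) (U : ℝ → ℝ) (η : ℝ) : ℝ :=
  (1 / Real.Gamma γ) * ∫ z in (0:ℝ)..1, (1 - z) ^ (γ - 1) * z ^ β * U (η * z ^ (1 / δ))

/-- The coefficients
`λ_k = ((−1)^k/Γ(γ)) ∫_0^1 (1−z)^{γ−1} z^β (1−z^{1/δ})^k dz`. -/
noncomputable def ekCoeff (β γ δ : ℝ) (k : ℕ) : ℝ :=
  ((-1 : ℝ) ^ k / Real.Gamma γ) *
    ∫ z in (0:ℝ)..1, (1 - z) ^ (γ - 1) * z ^ β * (1 - z ^ (1 / δ)) ^ k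

open MeasureTheory Set Filter Topology in
/-- A smooth function whose derivatives share a common bound is the sum of its Taylor series. -/
theorem hasSum_taylor_of_bounded_iteratedDeriv {U : ℝ → ℝ} (hU : ContDiff ℝ (⊤ : ℕ∞) U) {M : ℝ}
    (hM : ∀ (k : ℕ) (x : ℝ), |iteratedDeriv k U x| ≤ M) (x₀ x : ℝ) :
    HasSum (fun k : ℕ => iteratedDeriv k U x₀ * (x - x₀) ^ k / (k.factorial : ℝ)) (U x) := by
  have hsum : Summable fun k : ℕ =>
      ‖iteratedDeriv k U x₀ * (x - x₀) ^ k / (k.factorial : ℝ)‖ := by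
    refine Summable.of_nonneg_of_le (fun _ => norm_nonneg _) (fun k => ?_)
      ((Real.summable_pow_div_factorial |x - x₀|).mul_left M)
    rw [norm_div, norm_mul, norm_pow, Real.norm_natCast, Real.norm_eq_abs, Real.norm_eq_abs,
      mul_div_assoc]
    exact mul_le_mul_of_nonneg_right (hM k x₀) (by positivity)
  rw [hasSum_iff_tendsto_nat_of_summable_norm hsum, ← tendsto_add_atTop_iff_nat 1]
  rcases eq_or_ne x₀ x with rfl | hx
  · refine tendsto_const_nhds.congr fun n => ?_
    rw [Finset.sum_range_succ']
    simp
  have hlim : Tendsto (fun n : ℕ => M * (|x - x₀| ^ (n + 1) / ((n + 1).factorial : ℝ)))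
      atTop (𝓝 0) := by
    simpa using ((tendsto_add_atTop_iff_nat 1).2
      (FloorSemiring.tendsto_pow_div_factorial_atTop |x - x₀|)).const_mul M
  rw [tendsto_iff_dist_tendsto_zero]
  refine squeeze_zero (fun _ => dist_nonneg) (fun n => ?_) hlim
  obtain ⟨y, -, hy⟩ := taylor_mean_remainder_lagrange_iteratedDeriv (n := n) hx
    ((hU.of_le (by exact_mod_cast le_top)).contDiffOn)
  have hT : taylorWithinEval U n (uIcc x₀ x) x₀ x =
      ∑ k ∈ Finset.range (n + 1),
        iteratedDeriv k U x₀ * (x - x₀) ^ k / (k.factorial : ℝ) := by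
    rw [taylor_within_apply]
    refine Finset.sum_congr rfl fun k _ => ?_
    rw [iteratedDerivWithin_eq_iteratedDeriv (uniqueDiffOn_uIcc hx)
      (hU.of_le (by exact_mod_cast le_top)).contDiffAt left_mem_uIcc, smul_eq_mul]
    ring
  rw [dist_comm, Real.dist_eq, ← hT, hy, abs_div, abs_mul, abs_pow, Nat.abs_cast, mul_div_assoc]
  exact mul_le_mul_of_nonneg_right (hM (n + 1) y) (by positivity)

open MeasureTheory Set in
/-- The real Beta integrand is integrable on `[0, 1]`. -/
theorem intervalIntegrable_one_sub_rpow_mul_rpow {β γ : ℝ} (hβ : -1 < β) (hγ : 0 < γ) :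
    IntervalIntegrable (fun z : ℝ => (1 - z) ^ (γ - 1) * z ^ β) volume 0 1 := by
  have h := Complex.betaIntegral_convergent (u := ((β + 1 : ℝ) : ℂ)) (v := (γ : ℂ))
    (by rw [Complex.ofReal_re]; linarith) (by simpa)
  rw [intervalIntegrable_iff_integrableOn_Ioc_of_le zero_le_one] at h ⊢
  refine IntegrableOn.congr_fun h.re (fun z hz => ?_) measurableSet_Ioc
  have h1 : (z : ℂ) ^ (((β + 1 : ℝ) : ℂ) - 1) = ((z ^ β : ℝ) : ℂ) := by
    rw [Complex.ofReal_cpow hz.1.le]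
    push_cast
    ring_nf
  have h2 : (1 - (z : ℂ)) ^ ((γ : ℂ) - 1) = (((1 - z) ^ (γ - 1) : ℝ) : ℂ) := by
    rw [Complex.ofReal_cpow (sub_nonneg.2 hz.2)]
    push_cast
    rfl
  simp only [h1, h2, ← Complex.ofReal_mul, RCLike.re_to_complex, Complex.ofReal_re]
  ring

/-- series representation of the Erdélyi–Kober integral for smooth
functions with uniformly bounded derivatives, with absolute convergence. -/
theorem ek_series_representation (β γ δ : ℝ) (hβ : -1 < β) (hγ : 0 < γ) (hδ : 0 < δ)
    (U : ℝ → ℝ) (hU : ContDiff ℝ (⊤ : ℕ∞) U)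
    (hbdd : ∃ M : ℝ, ∀ (k : ℕ) (x : ℝ), |iteratedDeriv k U x| ≤ M) :
    ∀ η : ℝ,
      Summable (fun k : ℕ => |ekCoeff β γ δ k * iteratedDeriv k U η * η ^ k / (k.factorial : ℝ)|) ∧
      HasSum (fun k : ℕ => ekCoeff β γ δ k * iteratedDeriv k U η * η ^ k / (k.factorial : ℝ))
        (erdelyiKober β γ δ U η) := by
  intro η
  obtain ⟨M, hM⟩ := hbdd
  suffices h : HasSum (fun k : ℕ =>
      ekCoeff β γ δ k * iteratedDeriv k U η * η ^ k / (k.factorial : ℝ))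
      (erdelyiKober β γ δ U η) from ⟨h.summable.abs, h⟩
  set w : ℝ → ℝ := fun z => (1 - z) ^ (γ - 1) * z ^ β with hw
  have hwint : IntervalIntegrable w MeasureTheory.volume 0 1 :=
    intervalIntegrable_one_sub_rpow_mul_rpow hβ hγ
  have hwmeas : Measurable w := by fun_prop
  have hexp := Real.summable_pow_div_factorial |η|
  have key : HasSum
      (fun k : ℕ => ∫ z in (0:ℝ)..1,
        w z * (iteratedDeriv k U η * (η * z ^ (1 / δ) - η) ^ k / (k.factorial : ℝ)))
      (∫ z in (0:ℝ)..1, w z * U (η * z ^ (1 / δ))) := by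
    refine intervalIntegral.hasSum_integral_of_dominated_convergence
      (fun k z => w z * (M * (|η| ^ k / (k.factorial : ℝ)))) (fun k => ?_) (fun k => ?_) ?_ ?_ ?_
    · exact Measurable.aestronglyMeasurable (by fun_prop)
    · refine Filter.Eventually.of_forall fun z hz => ?_
      rw [Set.uIoc_of_le zero_le_one] at hz
      have hw0 : 0 ≤ w z :=
        mul_nonneg (Real.rpow_nonneg (sub_nonneg.2 hz.2) _) (Real.rpow_nonneg hz.1.le _)
      have hz0 : 0 ≤ z ^ (1 / δ) := Real.rpow_nonneg hz.1.le _
      have hz1 : z ^ (1 / δ) ≤ 1 := Real.rpow_le_one hz.1.le hz.2 (by positivity)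
      have hη : |η * z ^ (1 / δ) - η| ≤ |η| := by
        rw [show η * z ^ (1 / δ) - η = η * (z ^ (1 / δ) - 1) by ring, abs_mul]
        exact mul_le_of_le_one_right (abs_nonneg _) (abs_le.2 ⟨by linarith, by linarith⟩)
      rw [Real.norm_eq_abs, abs_mul, abs_of_nonneg hw0, abs_div, abs_mul, abs_pow, Nat.abs_cast,
        mul_div_assoc]
      have hM0 : 0 ≤ M := (abs_nonneg _).trans (hM 0 0)
      gcongr
      exact hM k η
    · exact Filter.Eventually.of_forall fun z _ => (hexp.mul_left M).mul_left (w z)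
    · simp_rw [tsum_mul_left]
      exact hwint.mul_const _
    · exact Filter.Eventually.of_forall fun z _ =>
        (hasSum_taylor_of_bounded_iteratedDeriv hU hM η _).mul_left (w z)
  refine (key.mul_left (1 / Real.Gamma γ)).congr_fun fun k => ?_
  have hk : ∀ z : ℝ,
      w z * (iteratedDeriv k U η * (η * z ^ (1 / δ) - η) ^ k / (k.factorial : ℝ)) =
      ((-1) ^ k * iteratedDeriv k U η * η ^ k / (k.factorial : ℝ)) *
        (w z * (1 - z ^ (1 / δ)) ^ k) := fun z => by
    rw [show η * z ^ (1 / δ) - η = (-1) * η * (1 - z ^ (1 / δ)) by ring, mul_pow, mul_pow]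
    ring
  simp_rw [hk, intervalIntegral.integral_const_mul, ekCoeff, hw]
  ring
end

section
/- Let β > −1, γ > 0, δ > 0. Then the coefficients λ_k satisfy the asymptotic relation λ_k ∼ (−1)^k (Γ(δ(β+1))/Γ(γ)) · δ / k^{δ(β+1)} as k → ∞; equivalently, lim_{k→∞} k^{δ(β+1)} (−1)^k λ_k = δ Γ(δ(β+1)) / Γ(γ). -/
open MeasureTheory Filter Set Topology

namespace EkCoeff

lemma rpow_le_of_half_le {x : ℝ} (hx : 1 / 2 ≤ x) (hx1 : x ≤ 1) (s : ℝ) :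
    x ^ s ≤ (1 / 2 : ℝ) ^ s + 1 := by
  rcases le_total 0 s with hs | hs
  · have h1 := Real.rpow_le_one (by linarith) hx1 hs
    have h2 : (0 : ℝ) ≤ (1 / 2 : ℝ) ^ s := by positivity
    linarith
  · have := Real.rpow_le_rpow_of_nonpos (by norm_num) hx hs
    linarith

/-- The integrand defining `ekCoeff`. -/
noncomputable def integrand (β γ δ : ℝ) (k : ℕ) (z : ℝ) : ℝ :=
  (1 - z) ^ (γ - 1) * z ^ β * (1 - z ^ (1 / δ)) ^ k

lemma measurable_integrand (β γ δ : ℝ) (k : ℕ) : Measurable (integrand β γ δ k) := by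
  unfold integrand; fun_prop

lemma norm_integrand_le_of_le_half {β γ δ z : ℝ} (hδ : 0 < δ) (k : ℕ) (hz : 0 < z)
    (hz2 : z ≤ 1 / 2) :
    ‖integrand β γ δ k z‖ ≤ ((1 / 2 : ℝ) ^ (γ - 1) + 1) * z ^ β := by
  have h1 := rpow_le_of_half_le (x := 1 - z) (by linarith) (by linarith) (γ - 1)
  have h2 : z ^ (1 / δ) ≤ 1 := Real.rpow_le_one hz.le (by linarith) (by positivity)
  have h3 : 0 ≤ z ^ (1 / δ) := by positivity
  have h4 : (1 - z ^ (1 / δ)) ^ k ≤ 1 := pow_le_one₀ (by linarith) (by linarith)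
  have h5 : 0 ≤ (1 - z ^ (1 / δ)) ^ k := pow_nonneg (by linarith) k
  have h6 : 0 ≤ (1 - z) ^ (γ - 1) := Real.rpow_nonneg (by linarith) _
  have h7 : 0 ≤ z ^ β := by positivity
  rw [integrand, Real.norm_of_nonneg (by positivity)]
  calc _ ≤ (1 - z) ^ (γ - 1) * z ^ β * 1 := by gcongr
    _ ≤ _ := by rw [mul_one]; gcongr

lemma norm_integrand_le_of_half_le {β γ δ z : ℝ} (hδ : 0 < δ) (k : ℕ) (hz : 1 / 2 ≤ z)
    (hz1 : z ≤ 1) :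
    ‖integrand β γ δ k z‖ ≤
      ((1 / 2 : ℝ) ^ β + 1) * (1 - (1 / 2 : ℝ) ^ (1 / δ)) ^ k * (1 - z) ^ (γ - 1) := by
  have h0 : 0 < z := by linarith
  have h1 := rpow_le_of_half_le hz hz1 β
  have h2 : z ^ (1 / δ) ≤ 1 := Real.rpow_le_one h0.le hz1 (by positivity)
  have h3 : (1 / 2 : ℝ) ^ (1 / δ) ≤ z ^ (1 / δ) :=
    Real.rpow_le_rpow (by norm_num) hz (by positivity)
  have h4 : (1 - z ^ (1 / δ)) ^ k ≤ (1 - (1 / 2 : ℝ) ^ (1 / δ)) ^ k :=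
    pow_le_pow_left₀ (by linarith) (by linarith) k
  have h5 : 0 ≤ (1 - z ^ (1 / δ)) ^ k := pow_nonneg (by linarith) k
  have h6 : 0 ≤ (1 - z) ^ (γ - 1) := Real.rpow_nonneg (by linarith) _
  have h7 : 0 ≤ z ^ β := by positivity
  rw [integrand, Real.norm_of_nonneg (by positivity)]
  calc _ = z ^ β * (1 - z ^ (1 / δ)) ^ k * (1 - z) ^ (γ - 1) := by ring
    _ ≤ _ := by gcongr

lemma integrableOn_one_sub_rpow {γ : ℝ} (hγ : 0 < γ) :
    IntegrableOn (fun z : ℝ => (1 - z) ^ (γ - 1)) (Ioc (1 / 2) 1) := by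
  have h := (intervalIntegral.intervalIntegrable_rpow' (a := 1 / 2) (b := 0) (r := γ - 1)
    (by linarith)).comp_sub_left 1
  rw [sub_zero, intervalIntegrable_iff_integrableOn_Ioc_of_le (by norm_num)] at h
  norm_num at h ⊢
  exact h

lemma integrableOn_integrand_left {β γ δ : ℝ} (hβ : -1 < β) (hδ : 0 < δ) (k : ℕ) :
    IntegrableOn (integrand β γ δ k) (Ioc 0 (1 / 2)) := by
  have h := intervalIntegral.intervalIntegrable_rpow' (a := 0) (b := 1 / 2) hβ
  rw [intervalIntegrable_iff_integrableOn_Ioc_of_le (by norm_num)] at h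
  refine (h.const_mul ((1 / 2 : ℝ) ^ (γ - 1) + 1)).mono'
    (measurable_integrand β γ δ k).aestronglyMeasurable ?_
  filter_upwards [ae_restrict_mem measurableSet_Ioc] with z hz
  exact norm_integrand_le_of_le_half hδ k hz.1 hz.2

lemma integrableOn_integrand_right {β γ δ : ℝ} (hγ : 0 < γ) (hδ : 0 < δ) (k : ℕ) :
    IntegrableOn (integrand β γ δ k) (Ioc (1 / 2) 1) := by
  refine ((integrableOn_one_sub_rpow hγ).const_mul
    (((1 / 2 : ℝ) ^ β + 1) * (1 - (1 / 2 : ℝ) ^ (1 / δ)) ^ k)).mono'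
    (measurable_integrand β γ δ k).aestronglyMeasurable ?_
  filter_upwards [ae_restrict_mem measurableSet_Ioc] with z hz
  exact norm_integrand_le_of_half_le hδ k hz.1.le hz.2

lemma tendsto_rpow_mul_pow_zero (p : ℝ) {r : ℝ} (hr0 : 0 ≤ r) (hr1 : r < 1) :
    Tendsto (fun k : ℕ => (k : ℝ) ^ p * r ^ k) atTop (𝓝 0) := by
  refine squeeze_zero' (Eventually.of_forall fun k => by positivity) ?_
    (tendsto_pow_const_mul_const_pow_of_lt_one ⌈p⌉₊ hr0 hr1)
  filter_upwards [eventually_ge_atTop 1] with k hk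
  have hk' : (1 : ℝ) ≤ k := by exact_mod_cast hk
  rw [← Real.rpow_natCast (k : ℝ)]
  gcongr
  exact Nat.le_ceil p

lemma tendsto_integral_right {β γ δ : ℝ} (hγ : 0 < γ) (hδ : 0 < δ) (p : ℝ) :
    Tendsto (fun k : ℕ => (k : ℝ) ^ p * ∫ z in Ioc (1 / 2) 1, integrand β γ δ k z)
      atTop (𝓝 0) := by
  have hr0 : 0 ≤ 1 - (1 / 2 : ℝ) ^ (1 / δ) :=
    sub_nonneg.2 (Real.rpow_le_one (by norm_num) (by norm_num) (by positivity))
  have hr1 : 1 - (1 / 2 : ℝ) ^ (1 / δ) < 1 := by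
    have : 0 < (1 / 2 : ℝ) ^ (1 / δ) := by positivity
    linarith
  have h := (tendsto_rpow_mul_pow_zero p hr0 hr1).mul_const
    (((1 / 2 : ℝ) ^ β + 1) * ∫ z in Ioc (1 / 2 : ℝ) 1, (1 - z) ^ (γ - 1))
  rw [zero_mul] at h
  refine squeeze_zero_norm (fun k => ?_) h
  have hb := norm_integral_le_of_norm_le
    ((integrableOn_one_sub_rpow hγ).const_mul
      (((1 / 2 : ℝ) ^ β + 1) * (1 - (1 / 2 : ℝ) ^ (1 / δ)) ^ k))
    (f := integrand β γ δ k) (by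
      filter_upwards [ae_restrict_mem measurableSet_Ioc] with z hz
      exact norm_integrand_le_of_half_le hδ k hz.1.le hz.2)
  rw [integral_const_mul] at hb
  rw [norm_mul, Real.norm_of_nonneg (by positivity : (0 : ℝ) ≤ (k : ℝ) ^ p)]
  calc _ ≤ (k : ℝ) ^ p * _ := mul_le_mul_of_nonneg_left hb (by positivity)
    _ = _ := by ring

/-- The integrand on `(0, 1/2]` after the substitution `z = w / k ^ δ`, extended by zero. -/
noncomputable def rescaled (β γ δ : ℝ) (k : ℕ) (w : ℝ) : ℝ :=
  (k : ℝ) ^ (δ * β) * (Ioc 0 (1 / 2)).indicator (integrand β γ δ k) ((k : ℝ) ^ (-δ) * w)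

lemma rpow_mul_integral_left (β γ δ : ℝ) {k : ℕ} (hk : 0 < k) :
    (k : ℝ) ^ (δ * (β + 1)) * ∫ z in Ioc 0 (1 / 2), integrand β γ δ k z =
      ∫ w in Ioi 0, rescaled β γ δ k w := by
  have hk' : (0 : ℝ) < k := by exact_mod_cast hk
  have hc : 0 < (k : ℝ) ^ (-δ) := by positivity
  simp only [rescaled]
  rw [integral_const_mul, integral_comp_mul_left_Ioi _ _ hc, mul_zero,
    setIntegral_indicator measurableSet_Ioc,
    inter_eq_self_of_subset_right Ioc_subset_Ioi_self, smul_eq_mul, ← mul_assoc,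
    ← Real.rpow_neg hk'.le, ← Real.rpow_add hk']
  ring_nf

lemma rescaled_eq {β γ δ w : ℝ} (hδ : 0 < δ) {k : ℕ} (hk : 0 < k) (hw : 0 < w)
    (hkw : (k : ℝ) ^ (-δ) * w ≤ 1 / 2) :
    rescaled β γ δ k w =
      (1 - (k : ℝ) ^ (-δ) * w) ^ (γ - 1) * w ^ β * (1 - w ^ (1 / δ) / k) ^ k := by
  have hk' : (0 : ℝ) < k := by exact_mod_cast hk
  have hc : 0 < (k : ℝ) ^ (-δ) := by positivity
  have e1 : ((k : ℝ) ^ (-δ) * w) ^ (1 / δ) = w ^ (1 / δ) / k := by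
    rw [Real.mul_rpow hc.le hw.le, ← Real.rpow_mul hk'.le,
      show -δ * (1 / δ) = -1 by field_simp, Real.rpow_neg_one]
    ring
  have e2 : (k : ℝ) ^ (δ * β) * ((k : ℝ) ^ (-δ) * w) ^ β = w ^ β := by
    rw [Real.mul_rpow hc.le hw.le, ← Real.rpow_mul hk'.le, ← mul_assoc, ← Real.rpow_add hk']
    simp
  rw [rescaled, indicator_of_mem (mem_Ioc.2 ⟨by positivity, hkw⟩), integrand, e1, ← e2]
  ring

lemma norm_rescaled_le {β γ δ w : ℝ} (hδ : 0 < δ) {k : ℕ} (hk : 0 < k) (hw : 0 < w) :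
    ‖rescaled β γ δ k w‖ ≤
      ((1 / 2 : ℝ) ^ (γ - 1) + 1) * (w ^ β * Real.exp (-w ^ (1 / δ))) := by
  have hk' : (0 : ℝ) < k := by exact_mod_cast hk
  have hc : 0 < (k : ℝ) ^ (-δ) * w := by positivity
  by_cases hkw : (k : ℝ) ^ (-δ) * w ≤ 1 / 2
  · have h1 := rpow_le_of_half_le (x := 1 - (k : ℝ) ^ (-δ) * w) (by linarith) (by linarith) (γ - 1)
    have h6 : 0 ≤ (1 - (k : ℝ) ^ (-δ) * w) ^ (γ - 1) := Real.rpow_nonneg (by linarith) _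
    have h2 : w ^ (1 / δ) ≤ k := by
      have hwk : w ≤ (k : ℝ) ^ δ := by
        rw [Real.rpow_neg hk'.le, inv_mul_le_iff₀ (by positivity)] at hkw
        have : 0 < (k : ℝ) ^ δ := by positivity
        linarith
      calc w ^ (1 / δ) ≤ ((k : ℝ) ^ δ) ^ (1 / δ) := by gcongr
        _ = k := by rw [← Real.rpow_mul hk'.le, mul_one_div_cancel hδ.ne', Real.rpow_one]
    have h3 := Real.one_sub_div_pow_le_exp_neg h2
    have h5 : 0 ≤ (1 - w ^ (1 / δ) / k) ^ k :=
      pow_nonneg (sub_nonneg.2 ((div_le_one hk').2 h2)) k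
    rw [rescaled_eq hδ hk hw hkw, Real.norm_of_nonneg (by positivity), mul_assoc]
    gcongr
  · rw [rescaled, indicator_of_notMem (fun h => hkw h.2), mul_zero, norm_zero]
    positivity

lemma tendsto_rescaled {β γ δ w : ℝ} (hδ : 0 < δ) (hw : 0 < w) :
    Tendsto (fun k : ℕ => rescaled β γ δ k w) atTop (𝓝 (w ^ β * Real.exp (-w ^ (1 / δ)))) := by
  have hc : Tendsto (fun k : ℕ => (k : ℝ) ^ (-δ) * w) atTop (𝓝 0) := by
    simpa using ((tendsto_rpow_neg_atTop hδ).comp tendsto_natCast_atTop_atTop).mul_const w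
  have h1 : Tendsto (fun k : ℕ => (1 - (k : ℝ) ^ (-δ) * w) ^ (γ - 1)) atTop (𝓝 1) := by
    have := (hc.const_sub 1).rpow_const (p := γ - 1) (Or.inl (by norm_num))
    simpa using this
  have h2 : Tendsto (fun k : ℕ => (1 - w ^ (1 / δ) / k) ^ k) atTop
      (𝓝 (Real.exp (-w ^ (1 / δ)))) := by
    simpa only [neg_div, ← sub_eq_add_neg] using
      Real.tendsto_one_add_div_pow_exp (-w ^ (1 / δ))
  have h := (h1.mul_const (w ^ β)).mul h2
  rw [one_mul] at h
  refine h.congr' ?_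
  filter_upwards [eventually_gt_atTop 0, hc.eventually_le_const (by norm_num : (0 : ℝ) < 1 / 2)]
    with k hk hkw
  exact (rescaled_eq hδ hk hw hkw).symm

lemma tendsto_integral_left {β γ δ : ℝ} (hβ : -1 < β) (hδ : 0 < δ) :
    Tendsto (fun k : ℕ => (k : ℝ) ^ (δ * (β + 1)) * ∫ z in Ioc 0 (1 / 2), integrand β γ δ k z)
      atTop (𝓝 (δ * Real.Gamma (δ * (β + 1)))) := by
  have hδ' : 0 < 1 / δ := by positivity
  have hlim := integral_rpow_mul_exp_neg_rpow hδ' hβ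
  rw [one_div_one_div, div_div_eq_mul_div, div_one, mul_comm (β + 1)] at hlim
  rw [← hlim]
  have h : Tendsto (fun k : ℕ => ∫ w in Ioi 0, rescaled β γ δ k w) atTop
      (𝓝 (∫ w in Ioi 0, w ^ β * Real.exp (-w ^ (1 / δ)))) := by
    refine tendsto_integral_filter_of_dominated_convergence
      (fun w => ((1 / 2 : ℝ) ^ (γ - 1) + 1) * (w ^ β * Real.exp (-w ^ (1 / δ)))) ?_ ?_
      ((integrableOn_rpow_mul_exp_neg_rpow hβ hδ').const_mul _) ?_
    · refine Eventually.of_forall fun k => Measurable.aestronglyMeasurable ?_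
      exact (((measurable_integrand β γ δ k).indicator measurableSet_Ioc).comp
        (measurable_const_mul _)).const_mul _
    · filter_upwards [eventually_gt_atTop 0] with k hk
      filter_upwards [ae_restrict_mem measurableSet_Ioi] with w hw
      exact norm_rescaled_le hδ hk hw
    · filter_upwards [ae_restrict_mem measurableSet_Ioi] with w hw
      exact tendsto_rescaled hδ hw
  refine h.congr' ?_
  filter_upwards [eventually_gt_atTop 0] with k hk
  exact (rpow_mul_integral_left β γ δ hk).symm

lemma neg_one_pow_mul_ekCoeff {β γ δ : ℝ} (hβ : -1 < β) (hγ : 0 < γ) (hδ : 0 < δ) (k : ℕ) :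
    (-1 : ℝ) ^ k * ekCoeff β γ δ k =
      ((∫ z in Ioc 0 (1 / 2), integrand β γ δ k z) +
        ∫ z in Ioc (1 / 2) 1, integrand β γ δ k z) / Real.Gamma γ := by
  have hsign : (-1 : ℝ) ^ k * (-1) ^ k = 1 := by rw [← mul_pow]; simp
  rw [← setIntegral_union (Ioc_disjoint_Ioc_of_le le_rfl) measurableSet_Ioc
    (integrableOn_integrand_left hβ hδ k) (integrableOn_integrand_right hγ hδ k),
    Ioc_union_Ioc_eq_Ioc (by norm_num) (by norm_num), ekCoeff,
    intervalIntegral.integral_of_le zero_le_one, div_mul_eq_mul_div, ← mul_div_assoc,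
    ← mul_assoc, hsign, one_mul]
  rfl

end EkCoeff

/-- the asymptotic relation
`λ_k ∼ (−1)^k (Γ(δ(β+1))/Γ(γ)) δ / k^{δ(β+1)}` as `k → ∞`, i.e.
`lim_{k→∞} k^{δ(β+1)} (−1)^k λ_k = δ Γ(δ(β+1)) / Γ(γ)`. -/
theorem ekCoeff_asymptotics (β γ δ : ℝ) (hβ : -1 < β) (hγ : 0 < γ) (hδ : 0 < δ) :
    Filter.Tendsto
      (fun k : ℕ => (k : ℝ) ^ (δ * (β + 1)) * ((-1 : ℝ) ^ k * ekCoeff β γ δ k))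
      Filter.atTop
      (nhds (δ * Real.Gamma (δ * (β + 1)) / Real.Gamma γ)) := by
  have h := ((EkCoeff.tendsto_integral_left (γ := γ) hβ hδ).add
    (EkCoeff.tendsto_integral_right (β := β) hγ hδ (δ * (β + 1)))).div_const (Real.Gamma γ)
  rw [add_zero] at h
  refine h.congr fun k => ?_
  rw [EkCoeff.neg_one_pow_mul_ekCoeff hβ hγ hδ, ← mul_add, mul_div_assoc]
end

section
/- Fix β > −1 and δ > 0, and regard λ_k = λ_k(γ) as a function of the parameter γ > 0. Then, as γ → 0⁺, λ_0(γ) → 1 and λ_k(γ) → 0 for every k ≥ 1. -/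
/-- On `[0, 1]` the complex beta integrand at real exponents is the real one. -/
lemma ofReal_beta_integrand (a b : ℝ) {z : ℝ} (hz : z ∈ Set.uIoc (0 : ℝ) 1) :
    (z : ℂ) ^ ((a : ℂ) - 1) * (1 - (z : ℂ)) ^ ((b : ℂ) - 1) =
      (((1 - z) ^ (b - 1) * z ^ (a - 1) : ℝ) : ℂ) := by
  rw [Set.uIoc_of_le zero_le_one] at hz
  rw [Complex.ofReal_mul, Complex.ofReal_cpow (sub_nonneg.2 hz.2), Complex.ofReal_cpow hz.1.le]
  push_cast
  ring

lemma intervalIntegrable_beta_integrand {a b : ℝ} (ha : 0 < a) (hb : 0 < b) :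
    IntervalIntegrable (fun z : ℝ => (1 - z) ^ (b - 1) * z ^ (a - 1))
      MeasureTheory.volume 0 1 := by
  have h := Complex.betaIntegral_convergent (u := a) (v := b) (by simpa) (by simpa)
  have h' := h.congr fun z hz => ofReal_beta_integrand a b hz
  rw [intervalIntegrable_iff] at h' ⊢
  simpa [MeasureTheory.IntegrableOn] using MeasureTheory.Integrable.re h'

lemma integral_beta_integrand {a b : ℝ} (ha : 0 < a) (hb : 0 < b) :
    ∫ z in (0 : ℝ)..1, (1 - z) ^ (b - 1) * z ^ (a - 1) =
      Real.Gamma a * Real.Gamma b / Real.Gamma (a + b) := by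
  have h := ProbabilityTheory.beta_eq_betaIntegralReal a b ha hb
  rw [Complex.betaIntegral, intervalIntegral.integral_congr_ae
    (Filter.Eventually.of_forall fun z hz => ofReal_beta_integrand a b hz),
    intervalIntegral.integral_ofReal, Complex.ofReal_re] at h
  exact h.symm

/-- Binomial expansion of the coefficients in terms of quotients of Gamma values. -/
lemma ekCoeff_eq_sum {β γ δ : ℝ} (hβ : -1 < β) (hγ : 0 < γ) (hδ : 0 < δ) (k : ℕ) :
    ekCoeff β γ δ k = (-1) ^ k * ∑ j ∈ Finset.range (k + 1), (-1) ^ j * (k.choose j : ℝ) *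
      (Real.Gamma (β + j / δ + 1) / Real.Gamma (β + j / δ + 1 + γ)) := by
  have hpos (j : ℕ) : 0 < β + j / δ + 1 := by
    have : 0 ≤ (j : ℝ) / δ := by positivity
    linarith
  have hexp : ∀ z ∈ Set.uIoc (0 : ℝ) 1,
      (1 - z) ^ (γ - 1) * z ^ β * (1 - z ^ (1 / δ)) ^ k =
        ∑ j ∈ Finset.range (k + 1), (-1) ^ j * (k.choose j : ℝ) *
          ((1 - z) ^ (γ - 1) * z ^ (β + j / δ + 1 - 1)) := by
    intro z hz
    rw [Set.uIoc_of_le zero_le_one] at hz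
    rw [sub_eq_neg_add 1 (z ^ (1 / δ)), add_pow, Finset.mul_sum]
    refine Finset.sum_congr rfl fun j _ => ?_
    have hzj : z ^ (β + j / δ + 1 - 1) = z ^ β * (z ^ (1 / δ)) ^ j := by
      rw [← Real.rpow_natCast, ← Real.rpow_mul hz.1.le, ← Real.rpow_add hz.1]
      congr 1
      ring
    rw [hzj, neg_pow]
    ring
  rw [ekCoeff, intervalIntegral.integral_congr_ae (Filter.Eventually.of_forall hexp),
    intervalIntegral.integral_finsetSum fun j _ =>
      (intervalIntegrable_beta_integrand (hpos j) hγ).const_mul _]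
  simp_rw [intervalIntegral.integral_const_mul, integral_beta_integrand (hpos _) hγ]
  rw [div_mul_eq_mul_div, mul_div_assoc, Finset.sum_div]
  congr 1
  refine Finset.sum_congr rfl fun j _ => ?_
  have := (Real.Gamma_pos_of_pos hγ).ne'
  have := (Real.Gamma_pos_of_pos (add_pos (hpos j) hγ)).ne'
  field_simp

lemma tendsto_Gamma_div_Gamma_add {a : ℝ} (ha : 0 < a) :
    Filter.Tendsto (fun γ : ℝ => Real.Gamma a / Real.Gamma (a + γ)) (nhds 0) (nhds 1) := by
  have hc : ContinuousAt Real.Gamma (a + 0) := by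
    refine (Real.differentiableAt_Gamma fun m => ?_).continuousAt
    have : (0 : ℝ) ≤ m := m.cast_nonneg
    linarith
  have hne := (Real.Gamma_pos_of_pos ha).ne'
  have h : ContinuousAt (fun γ : ℝ => Real.Gamma a / Real.Gamma (a + γ)) 0 :=
    continuousAt_const.div
      (ContinuousAt.comp (f := fun γ : ℝ => a + γ) hc (by fun_prop)) (by simpa using hne)
  simpa [ContinuousAt, div_self hne] using h

lemma tendsto_ekCoeff {β δ : ℝ} (hβ : -1 < β) (hδ : 0 < δ) (k : ℕ) :
    Filter.Tendsto (fun γ : ℝ => ekCoeff β γ δ k) (nhdsWithin 0 (Set.Ioi 0))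
      (nhds ((-1) ^ k * ∑ j ∈ Finset.range (k + 1), (-1) ^ j * (k.choose j : ℝ))) := by
  have h : Filter.Tendsto (fun γ : ℝ => (-1 : ℝ) ^ k * ∑ j ∈ Finset.range (k + 1),
      (-1) ^ j * (k.choose j : ℝ) *
        (Real.Gamma (β + j / δ + 1) / Real.Gamma (β + j / δ + 1 + γ)))
      (nhdsWithin 0 (Set.Ioi 0))
      (nhds ((-1) ^ k * ∑ j ∈ Finset.range (k + 1), (-1) ^ j * (k.choose j : ℝ) * 1)) := by
    refine (tendsto_finsetSum _ fun j _ => ?_).const_mul _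
    have : 0 ≤ (j : ℝ) / δ := by positivity
    exact ((tendsto_Gamma_div_Gamma_add (by linarith)).mono_left nhdsWithin_le_nhds).const_mul _
  simp only [mul_one] at h
  refine h.congr' ?_
  filter_upwards [self_mem_nhdsWithin] with γ hγ
  exact (ekCoeff_eq_sum hβ hγ hδ k).symm

/-- as `γ → 0⁺`, `λ_0(γ) → 1` and `λ_k(γ) → 0` for every `k ≥ 1`. -/
theorem ekCoeff_limit_gamma_zero (β δ : ℝ) (hβ : -1 < β) (hδ : 0 < δ) :
    Filter.Tendsto (fun γ : ℝ => ekCoeff β γ δ 0) (nhdsWithin 0 (Set.Ioi 0)) (nhds 1) ∧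
    ∀ k : ℕ, 1 ≤ k →
      Filter.Tendsto (fun γ : ℝ => ekCoeff β γ δ k) (nhdsWithin 0 (Set.Ioi 0)) (nhds 0) := by
  refine ⟨by simpa using tendsto_ekCoeff hβ hδ 0, fun k hk => ?_⟩
  have hsum : ∑ j ∈ Finset.range (k + 1), (-1) ^ j * (k.choose j : ℝ) = 0 := by
    exact_mod_cast Int.alternating_sum_range_choose_of_ne (Nat.one_le_iff_ne_zero.1 hk)
  simpa [hsum] using tendsto_ekCoeff hβ hδ k
end

section
/- Let 0 < α < 1, a > −1, b > 0, and let U : [0,∞) → ℝ be continuously differentiable with U(η) = 0 for all η ≥ η* for some η* > 0. Define the self-similar function u(x,t) = t^a U(x t^{−b}) for x > 0, t > 0, and let G(η) = I^{a,1−α}_{−1/b} U(η) = (1/Γ(1−α)) ∫_0^1 (1−s)^{−α} s^a U(η s^{−b}) ds. Then for all x > 0 and t > 0 the Riemann–Liouville fractional derivative of u of order α in time satisfies ∂_t^α u(x,t) = t^{a−α} [ (a−α+1) G(η) − b η G'(η) ], where η = x t^{−b}. -/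
open MeasureTheory intervalIntegral Set Filter Topology in
/-- The real Beta weight is integrable on the unit interval. -/
theorem intervalIntegrable_one_sub_rpow_mul_rpow_s12 {p q : ℝ} (hp : -1 < p) (hq : -1 < q) :
    IntervalIntegrable (fun s : ℝ => (1 - s) ^ p * s ^ q) volume 0 1 := by
  have h := (Complex.betaIntegral_convergent (u := ((q + 1 : ℝ) : ℂ)) (v := ((p + 1 : ℝ) : ℂ))
    (by rw [Complex.ofReal_re]; linarith) (by rw [Complex.ofReal_re]; linarith)).norm
  refine h.congr_uIoo fun s hs => ?_
  rw [uIoo_of_le zero_le_one] at hs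
  have hs1 : 0 < 1 - s := sub_pos.2 hs.2
  have e1 : ((q + 1 : ℝ) : ℂ) - 1 = (q : ℂ) := by push_cast; ring
  have e2 : ((p + 1 : ℝ) : ℂ) - 1 = (p : ℂ) := by push_cast; ring
  have e3 : (1 - (s : ℂ)) = ((1 - s : ℝ) : ℂ) := by push_cast; ring
  simp only [e1, e2, e3, norm_mul, Complex.norm_cpow_eq_rpow_re_of_pos hs.1,
    Complex.norm_cpow_eq_rpow_re_of_pos hs1, Complex.ofReal_re]
  ring

/-- A continuous function vanishing on a right half-line is bounded on `[0, ∞)`. -/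
theorem exists_bound_of_continuous_of_eq_zero {f : ℝ → ℝ} (hf : Continuous f) {R : ℝ}
    (hR : ∀ x, R < x → f x = 0) : ∃ M, 0 ≤ M ∧ ∀ x, 0 ≤ x → |f x| ≤ M := by
  obtain ⟨M, hM⟩ := (isCompact_Icc (a := (0 : ℝ)) (b := R)).exists_bound_of_continuousOn
    hf.continuousOn
  refine ⟨max M 0, le_max_right _ _, fun x hx => ?_⟩
  rcases le_or_gt x R with h | h
  · exact (hM x ⟨hx, h⟩).trans (le_max_left _ _)
  · simp [hR x h]

open MeasureTheory intervalIntegral Set Filter Topology in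
/-- The Erdélyi–Kober integral of a compactly supported `C¹` profile is differentiable at positive
arguments. -/
theorem differentiableAt_erdelyiKober {p a b R η : ℝ} (hp : -1 < p) (ha : -1 < a) {U : ℝ → ℝ}
    (hU : ContDiff ℝ 1 U) (hR : ∀ x, R ≤ x → U x = 0) (hη : 0 < η) :
    DifferentiableAt ℝ
      (fun η => ∫ s in (0 : ℝ)..1, (1 - s) ^ p * s ^ a * U (η * s ^ (-b))) η := by
  have hw := intervalIntegrable_one_sub_rpow_mul_rpow_s12 hp ha
  have hU' : Continuous (deriv U) := hU.continuous_deriv le_rfl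
  have hR' : ∀ x, R < x → x * deriv U x = 0 := fun x hx => by
    have : U =ᶠ[𝓝 x] fun _ => 0 := by
      filter_upwards [Ioi_mem_nhds hx] with y hy using hR y (le_of_lt hy)
    rw [this.deriv_eq]; simp
  obtain ⟨M, hM0, hM⟩ := exists_bound_of_continuous_of_eq_zero hU.continuous
    (fun x hx => hR x hx.le)
  obtain ⟨N, hN0, hN⟩ := exists_bound_of_continuous_of_eq_zero (continuous_id.mul hU') hR'
  have hmeas : ∀ x : ℝ, Measurable fun s : ℝ => (1 - s) ^ p * s ^ a * U (x * s ^ (-b)) :=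
    fun x => ((by fun_prop : Measurable fun s : ℝ => (1 - s) ^ p * s ^ a)).mul
      (hU.continuous.measurable.comp (by fun_prop))
  have key := hasDerivAt_integral_of_dominated_loc_of_deriv_le (μ := volume) (a := (0 : ℝ)) (b := 1)
    (F := fun x s => (1 - s) ^ p * s ^ a * U (x * s ^ (-b)))
    (F' := fun x s => (1 - s) ^ p * s ^ a * (deriv U (x * s ^ (-b)) * s ^ (-b)))
    (x₀ := η) (s := Ioi (η / 2)) (bound := fun s => (1 - s) ^ p * s ^ a * (N / (η / 2)))
    (Ioi_mem_nhds (by linarith)) (.of_forall fun x => (hmeas x).aestronglyMeasurable)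
    ?_ ?_ ?_ (hw.mul_const _) ?_
  · exact key.2.differentiableAt
  · refine (hw.mul_const M).mono_fun (hmeas η).aestronglyMeasurable ?_
    refine (ae_restrict_iff' measurableSet_uIoc).2 (.of_forall fun s hs => ?_)
    rw [uIoc_of_le zero_le_one] at hs
    have h1 := hM (η * s ^ (-b)) (mul_nonneg hη.le (Real.rpow_nonneg hs.1.le _))
    simp only [norm_mul]
    gcongr
    exact h1.trans (le_abs_self M)
  · exact (((by fun_prop : Measurable fun s : ℝ => (1 - s) ^ p * s ^ a)).mul
      ((hU'.measurable.comp (by fun_prop)).mul (by fun_prop))).aestronglyMeasurable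
  · refine .of_forall fun s hs x hx => ?_
    rw [uIoc_of_le zero_le_one] at hs
    have hx' : η / 2 < x := hx
    have hx0 : 0 < x := by linarith
    have hsb : 0 < s ^ (-b) := Real.rpow_pos_of_pos hs.1 _
    have hnn : 0 ≤ (1 - s) ^ p * s ^ a :=
      mul_nonneg (Real.rpow_nonneg (sub_nonneg.2 hs.2) _) (Real.rpow_nonneg hs.1.le _)
    have h1 : |x * s ^ (-b) * deriv U (x * s ^ (-b))| ≤ N :=
      hN (x * s ^ (-b)) (mul_nonneg hx0.le hsb.le)
    rw [norm_mul, Real.norm_of_nonneg hnn]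
    refine mul_le_mul_of_nonneg_left ?_ hnn
    rw [le_div_iff₀ (by linarith), Real.norm_eq_abs]
    calc |deriv U (x * s ^ (-b)) * s ^ (-b)| * (η / 2)
        ≤ |deriv U (x * s ^ (-b)) * s ^ (-b)| * x := by gcongr
      _ = |x * s ^ (-b) * deriv U (x * s ^ (-b))| := by
        rw [← abs_of_pos hx0, ← abs_mul, abs_of_pos hx0]; ring_nf
      _ ≤ N := h1
  · refine .of_forall fun s _ x _ => ?_
    have h1 : HasDerivAt U (deriv U (x * s ^ (-b))) (x * s ^ (-b)) :=
      ((hU.differentiable one_ne_zero) _).hasDerivAt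
    have h2 : HasDerivAt (fun x : ℝ => x * s ^ (-b)) (s ^ (-b)) x := by
      simpa using (hasDerivAt_id x).mul_const (s ^ (-b))
    exact (h1.comp x h2).const_mul _

open intervalIntegral Set in
/-- Rescaling the fractional integral of a self-similar function to the unit interval. -/
theorem integral_sub_rpow_mul_selfSimilar (p a b x : ℝ) {τ : ℝ} (hτ : 0 < τ) (U : ℝ → ℝ) :
    ∫ s in (0 : ℝ)..τ, (τ - s) ^ p * (s ^ a * U (x * s ^ (-b))) =
      τ ^ (a + p + 1) *
        ∫ s in (0 : ℝ)..1, (1 - s) ^ p * s ^ a * U (x * τ ^ (-b) * s ^ (-b)) := by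
  have h := smul_integral_comp_mul_left (a := 0) (b := 1)
    (fun s => (τ - s) ^ p * (s ^ a * U (x * s ^ (-b)))) τ
  rw [mul_zero, mul_one] at h
  rw [← h, smul_eq_mul, ← integral_const_mul, ← integral_const_mul]
  refine integral_congr fun s hs => ?_
  rw [uIcc_of_le zero_le_one] at hs
  have e : τ - τ * s = τ * (1 - s) := by ring
  simp only [e]
  rw [Real.mul_rpow hτ.le (sub_nonneg.2 hs.2), Real.mul_rpow hτ.le hs.1, Real.mul_rpow hτ.le hs.1,
    Real.rpow_add hτ, Real.rpow_add hτ, Real.rpow_one, mul_assoc x]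
  ring

/-- for a compactly supported `C¹` self-similar profile `U`, the
Riemann–Liouville time-fractional derivative of `u(x,t) = t^a U(x t^{−b})` equals
`t^{a−α} [ (a−α+1) G(η) − b η G'(η) ]` with `η = x t^{−b}`, where
`G = I^{a,1−α}_{−1/b} U` is the Erdélyi–Kober fractional integral of `U`. -/
theorem riemannLiouville_selfSimilar (α a b ηstar : ℝ)
    (hα0 : 0 < α) (hα1 : α < 1) (ha : -1 < a) (hb : 0 < b) (hηstar : 0 < ηstar)
    (U : ℝ → ℝ) (hU : ContDiff ℝ 1 U) (hsupp : ∀ η : ℝ, ηstar ≤ η → U η = 0)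
    (u : ℝ → ℝ → ℝ) (hu : ∀ x t : ℝ, u x t = t ^ a * U (x * t ^ (-b)))
    (G : ℝ → ℝ)
    (hG : ∀ η : ℝ, G η =
      (1 / Real.Gamma (1 - α)) * ∫ s in (0:ℝ)..1, (1 - s) ^ (-α) * s ^ a * U (η * s ^ (-b))) :
    ∀ x t : ℝ, 0 < x → 0 < t →
      deriv (fun τ : ℝ =>
          (1 / Real.Gamma (1 - α)) * ∫ s in (0:ℝ)..τ, (τ - s) ^ (-α) * u x s) t
        = t ^ (a - α) *
            ((a - α + 1) * G (x * t ^ (-b)) -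
              b * (x * t ^ (-b)) * deriv G (x * t ^ (-b))) := by
  intro x t hx ht
  have hη : 0 < x * t ^ (-b) := mul_pos hx (Real.rpow_pos_of_pos ht _)
  have hGd : DifferentiableAt ℝ G (x * t ^ (-b)) := by
    rw [funext hG]
    exact (differentiableAt_erdelyiKober (by linarith) ha hU hsupp hη).const_mul _
  have hev : (fun τ : ℝ =>
      (1 / Real.Gamma (1 - α)) * ∫ s in (0:ℝ)..τ, (τ - s) ^ (-α) * u x s) =ᶠ[nhds t]
      fun τ => τ ^ (a - α + 1) * G (x * τ ^ (-b)) := by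
    filter_upwards [Ioi_mem_nhds ht] with τ hτ
    simp only [hu]
    rw [integral_sub_rpow_mul_selfSimilar _ _ _ _ hτ, hG, ← sub_eq_add_neg]
    ring
  have h1 : HasDerivAt (fun τ : ℝ => τ ^ (a - α + 1)) ((a - α + 1) * t ^ (a - α + 1 - 1)) t :=
    Real.hasDerivAt_rpow_const (Or.inl ht.ne')
  have h2 : HasDerivAt (fun τ : ℝ => x * τ ^ (-b)) (x * (-b * t ^ (-b - 1))) t :=
    (Real.hasDerivAt_rpow_const (Or.inl ht.ne')).const_mul x
  have h3 := h1.mul (hGd.hasDerivAt.comp t h2)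
  rw [hev.deriv_eq]
  refine h3.deriv.trans ?_
  have e1 : t ^ (a - α + 1) = t ^ (a - α) * t := by rw [Real.rpow_add ht, Real.rpow_one]
  have e2 : t ^ (-b - 1) = t ^ (-b) / t := by rw [Real.rpow_sub ht, Real.rpow_one]
  simp only [Function.comp_apply]
  rw [add_sub_cancel_right, e1, e2]
  field_simp
  ring
end

section
/- Let m > 0, B ≠ 0 and A ∈ ℝ, and let y be five times continuously differentiable on a neighborhood of 0 satisfying (1/m) y'(z)² + y(z) y''(z) = A y(z) + (B/m)(1−z) y'(z) there, with y(0) = 0 and y'(0) = B. Set a_k = y^(k)(0)/k!. Then a_2 = (A m − B)/(2(1+m)), a_3 = (A + B) m (B − A m) / (6 B (1+m)² (1+2m)), and a_4 = (A + B) m (B − A m)(B(3+m) − A m (5+3m)) / (24 B² (1+m)³ (1 + m(5+6m))). -/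
/-- A `C^n` function on an open set has iterated derivatives of order less than `n` that are
differentiable there. -/
theorem hasDerivAt_iteratedDeriv_of_contDiffOn {n k : ℕ} {s : Set ℝ} {f : ℝ → ℝ}
    (hf : ContDiffOn ℝ n f s) (hs : IsOpen s) (hk : k < n) {z : ℝ} (hz : z ∈ s) :
    HasDerivAt (iteratedDeriv k f) (iteratedDeriv (k + 1) f z) z := by
  rw [iteratedDeriv_succ]
  have h := (hf.differentiableOn_iteratedDerivWithin (m := k) (by exact_mod_cast hk)
    hs.uniqueDiffOn).differentiableAt (hs.mem_nhds hz)
  refine (h.congr_of_eventuallyEq ?_).hasDerivAt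
  filter_upwards [hs.mem_nhds hz] with x hx
  exact (iteratedDerivWithin_of_isOpen hs hx).symm

/-- The derivative of a function vanishing on an open set vanishes there. -/
theorem eq_zero_of_hasDerivAt_of_eqOn_zero {s : Set ℝ} (hs : IsOpen s) {f f' : ℝ → ℝ}
    (hf : ∀ z ∈ s, f z = 0) (hf' : ∀ z ∈ s, HasDerivAt f (f' z) z) : ∀ z ∈ s, f' z = 0 := by
  intro z hz
  refine (hf' z hz).unique ((hasDerivAt_const z (0 : ℝ)).congr_of_eventuallyEq ?_)
  filter_upwards [hs.mem_nhds hz] with x hx using hf x hx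

/-- the first Taylor coefficients `a_2, a_3, a_4` of a solution of
`(1/m) y'² + y y'' = A y + (B/m)(1−z) y'` near `0` with `y(0) = 0`, `y'(0) = B`. -/
theorem ode_taylor_coefficients (m A B ε : ℝ) (hm : 0 < m) (hB : B ≠ 0) (hε : 0 < ε)
    (y : ℝ → ℝ) (hy : ContDiffOn ℝ (5 : ℕ) y (Set.Ioo (-ε) ε))
    (hode : ∀ z ∈ Set.Ioo (-ε) ε,
      (1 / m) * (deriv y z) ^ 2 + y z * deriv (deriv y) z
        = A * y z + (B / m) * (1 - z) * deriv y z)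
    (h0 : y 0 = 0) (h1 : deriv y 0 = B)
    (a : ℕ → ℝ) (ha : ∀ k : ℕ, a k = iteratedDeriv k y 0 / (k.factorial : ℝ)) :
    a 2 = (A * m - B) / (2 * (1 + m)) ∧
    a 3 = (A + B) * m * (B - A * m) / (6 * B * (1 + m) ^ 2 * (1 + 2 * m)) ∧
    a 4 = (A + B) * m * (B - A * m) * (B * (3 + m) - A * m * (5 + 3 * m)) /
        (24 * B ^ 2 * (1 + m) ^ 3 * (1 + m * (5 + 6 * m))) := by
  have hs : IsOpen (Set.Ioo (-ε) ε) := isOpen_Ioo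
  have hmem : (0 : ℝ) ∈ Set.Ioo (-ε) ε := ⟨by linarith, hε⟩
  have hd : ∀ k < 5, ∀ z ∈ Set.Ioo (-ε) ε,
      HasDerivAt (iteratedDeriv k y) (iteratedDeriv (k + 1) y z) z :=
    fun k hk z hz => hasDerivAt_iteratedDeriv_of_contDiffOn hy hs hk hz
  rw [← iteratedDeriv_one] at h1
  replace h0 : iteratedDeriv 0 y 0 = 0 := by rw [iteratedDeriv_zero, h0]
  have e0 : ∀ z ∈ Set.Ioo (-ε) ε, iteratedDeriv 1 y z ^ 2
      + m * (iteratedDeriv 0 y z * iteratedDeriv 2 y z)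
      - A * m * iteratedDeriv 0 y z - B * ((1 - z) * iteratedDeriv 1 y z) = 0 := by
    intro z hz
    have h := hode z hz
    rw [iteratedDeriv_succ (n := 1), iteratedDeriv_one, iteratedDeriv_zero]
    field_simp at h
    linear_combination h
  have d0 := hd 0 (by norm_num)
  have d1 := hd 1 (by norm_num)
  have d2 := hd 2 (by norm_num)
  have d3 := hd 3 (by norm_num)
  have d4 := hd 4 (by norm_num)
  have hlin : ∀ z : ℝ, HasDerivAt (fun x : ℝ => 1 - x) (-1) z :=
    fun z => (hasDerivAt_id z).const_sub 1
  rw [ha 2, ha 3, ha 4]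
  clear hd hode hy ha
  norm_num only at d0 d1 d2 d3 d4
  generalize iteratedDeriv 0 y = y0, iteratedDeriv 1 y = y1, iteratedDeriv 2 y = y2,
    iteratedDeriv 3 y = y3, iteratedDeriv 4 y = y4, iteratedDeriv 5 y = y5 at *
  have e1 : ∀ z ∈ Set.Ioo (-ε) ε, 2 * (y1 z * y2 z) + m * (y1 z * y2 z + y0 z * y3 z)
      - A * m * y1 z - B * ((1 - z) * y2 z - y1 z) = 0 := by
    refine eq_zero_of_hasDerivAt_of_eqOn_zero hs e0 fun z hz => ?_
    refine (((((d1 z hz).pow 2).add (((d0 z hz).mul (d2 z hz)).const_mul m)).sub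
      ((d0 z hz).const_mul (A * m))).sub
      (((hlin z).mul (d1 z hz)).const_mul B)).congr_deriv ?_
    norm_num
    ring
  have e2 : ∀ z ∈ Set.Ioo (-ε) ε, 2 * (y2 z * y2 z + y1 z * y3 z)
      + m * (y2 z * y2 z + 2 * (y1 z * y3 z) + y0 z * y4 z)
      - A * m * y2 z - B * ((1 - z) * y3 z - 2 * y2 z) = 0 := by
    refine eq_zero_of_hasDerivAt_of_eqOn_zero hs e1 fun z hz => ?_
    have p := (d1 z hz).mul (d2 z hz)
    refine ((((p.const_mul 2).add ((p.add ((d0 z hz).mul (d3 z hz))).const_mul m)).sub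
      ((d1 z hz).const_mul (A * m))).sub
      ((((hlin z).mul (d2 z hz)).sub (d1 z hz)).const_mul B)).congr_deriv ?_
    ring
  have e3 : ∀ z ∈ Set.Ioo (-ε) ε, 2 * (3 * (y2 z * y3 z) + y1 z * y4 z)
      + m * (4 * (y2 z * y3 z) + 3 * (y1 z * y4 z) + y0 z * y5 z)
      - A * m * y3 z - B * ((1 - z) * y4 z - 3 * y3 z) = 0 := by
    refine eq_zero_of_hasDerivAt_of_eqOn_zero hs e2 fun z hz => ?_
    have p := (d2 z hz).mul (d2 z hz)
    have q := (d1 z hz).mul (d3 z hz)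
    refine (((((p.add q).const_mul 2).add
      (((p.add (q.const_mul 2)).add ((d0 z hz).mul (d4 z hz))).const_mul m)).sub
      ((d2 z hz).const_mul (A * m))).sub
      ((((hlin z).mul (d3 z hz)).sub ((d2 z hz).const_mul 2)).const_mul B)).congr_deriv ?_
    ring
  have f1 := e1 0 hmem
  have f2 := e2 0 hmem
  have f3 := e3 0 hmem
  rw [h0, h1] at f1 f2 f3
  have hm1 : 1 + m ≠ 0 := by positivity
  have hm2 : 1 + 2 * m ≠ 0 := by positivity
  have hm3 : 1 + 3 * m ≠ 0 := by positivity
  have c2 : y2 0 = (A * m - B) / (1 + m) := by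
    rw [eq_div_iff hm1]
    apply mul_left_cancel₀ hB
    linear_combination f1
  have c3 : y3 0 = (A + B) * m * (B - A * m) / (B * (1 + m) ^ 2 * (1 + 2 * m)) := by
    have h : B * (1 + 2 * m) * y3 0 = -(y2 0 * ((2 + m) * y2 0 - A * m + 2 * B)) := by
      linear_combination f2
    rw [← mul_right_inj' (mul_ne_zero hB hm2), h, c2]
    field_simp
    ring
  have c4 : y4 0 = (A + B) * m * (B - A * m) * (B * (3 + m) - A * m * (5 + 3 * m)) /
      (B ^ 2 * (1 + m) ^ 3 * ((1 + 2 * m) * (1 + 3 * m))) := by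
    have h : B * (1 + 3 * m) * y4 0 = -(y3 0 * ((6 + 4 * m) * y2 0 - A * m + 3 * B)) := by
      linear_combination f3
    rw [← mul_right_inj' (mul_ne_zero hB hm3), h, c2, c3]
    field_simp
    ring
  have hfac : 1 + m * (5 + 6 * m) = (1 + 2 * m) * (1 + 3 * m) := by ring
  rw [hfac, c2, c3, c4]
  norm_num [Nat.factorial]
  refine ⟨?_, ?_, ?_⟩ <;> field_simp
end

section
/- Let A > 0 and B > 0, and define y_0(z) = A z²/2 + B z and y_1(z) = −2(A+B) [ z²/2 − (B/A)( (z + 2B/A)(ln(1 + (A/(2B)) z) − 1) + 2B/A ) ] for z > −2B/A. Then y_0 satisfies y_0(z) y_0''(z) = A y_0(z) with y_0(0) = 0, y_0'(0) = B, and y_1 satisfies y_0'(z)² + y_0(z) y_1''(z) + y_1(z) y_0''(z) = A y_1(z) + B(1−z) y_0'(z) for all z > −2B/A, with y_1(0) = 0 and y_1'(0) = 0. -/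
/-- the zeroth- and first-order terms of the large-`m` perturbation
expansion: `y₀(z) = A z²/2 + B z` solves `y₀ y₀'' = A y₀` with `y₀(0) = 0`,
`y₀'(0) = B`, and the explicit `y₁` solves
`y₀'² + y₀ y₁'' + y₁ y₀'' = A y₁ + B(1−z) y₀'` for `z > −2B/A`, with
`y₁(0) = 0`, `y₁'(0) = 0`. -/
theorem perturbation_terms (A B : ℝ) (hA : 0 < A) (hB : 0 < B)
    (y0 y1 : ℝ → ℝ)
    (hy0 : ∀ z : ℝ, y0 z = A * z ^ 2 / 2 + B * z)
    (hy1 : ∀ z : ℝ, y1 z =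
      -2 * (A + B) *
        (z ^ 2 / 2 -
          (B / A) * ((z + 2 * B / A) * (Real.log (1 + (A / (2 * B)) * z) - 1) + 2 * B / A))) :
    (∀ z : ℝ, y0 z * deriv (deriv y0) z = A * y0 z) ∧
    y0 0 = 0 ∧ deriv y0 0 = B ∧
    (∀ z : ℝ, -2 * B / A < z →
      (deriv y0 z) ^ 2 + y0 z * deriv (deriv y1) z + y1 z * deriv (deriv y0) z
        = A * y1 z + B * (1 - z) * deriv y0 z) ∧
    y1 0 = 0 ∧ deriv y1 0 = 0 := by
  have hd0 : deriv y0 = fun z => A * z + B := by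
    funext z
    rw [funext hy0]
    have h := (((hasDerivAt_pow 2 z).const_mul A).div_const 2).add ((hasDerivAt_id z).const_mul B)
    refine (h.congr_deriv ?_).deriv
    norm_num
    ring
  have hdd0 : deriv (deriv y0) = fun _ => A := by
    funext z
    rw [hd0]
    refine ((((hasDerivAt_id z).const_mul A).add_const B).congr_deriv ?_).deriv
    ring
  have hpos : ∀ z : ℝ, -2 * B / A < z → 0 < A * z + 2 * B := by
    intro z hz
    rw [div_lt_iff₀ hA] at hz
    linarith
  have hlog : ∀ z : ℝ, -2 * B / A < z →
      HasDerivAt (fun x => Real.log (1 + A / (2 * B) * x)) (A / (A * z + 2 * B)) z := by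
    intro z hz
    have hp := hpos z hz
    have hu : 1 + A / (2 * B) * z = (A * z + 2 * B) / (2 * B) := by
      field_simp
      ring
    have hlin : HasDerivAt (fun x : ℝ => 1 + A / (2 * B) * x) (A / (2 * B)) z := by
      simpa using ((hasDerivAt_id z).const_mul (A / (2 * B))).const_add 1
    refine (hlin.log (by rw [hu]; positivity)).congr_deriv ?_
    rw [hu]
    field_simp
  have hd1 : ∀ z : ℝ, -2 * B / A < z →
      deriv y1 z = -2 * (A + B) * (z - B / A * Real.log (1 + A / (2 * B) * z)) := by
    intro z hz
    have hp := hpos z hz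
    rw [funext hy1]
    have h := (((hasDerivAt_pow 2 z).div_const 2).sub
      (((((hasDerivAt_id z).add_const (2 * B / A)).mul ((hlog z hz).sub_const 1)).add_const
        (2 * B / A)).const_mul (B / A))).const_mul (-2 * (A + B))
    refine (h.congr_deriv ?_).deriv
    have hcancel : (z + 2 * B / A) * (A / (A * z + 2 * B)) = 1 := by
      rw [add_div' _ _ _ hA.ne', mul_comm z A, div_mul_div_cancel₀ hA.ne', div_self hp.ne']
    simp only [id, hcancel]
    norm_num
  have hdd1 : ∀ z : ℝ, -2 * B / A < z →
      deriv (deriv y1) z = -2 * (A + B) * (1 - B / A * (A / (A * z + 2 * B))) := by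
    intro z hz
    have hev : deriv y1 =ᶠ[nhds z]
        fun x => -2 * (A + B) * (x - B / A * Real.log (1 + A / (2 * B) * x)) :=
      (eventually_gt_nhds hz).mono hd1
    rw [hev.deriv_eq]
    exact (((hasDerivAt_id z).sub ((hlog z hz).const_mul (B / A))).const_mul (-2 * (A + B))).deriv
  have hzero : -2 * B / A < 0 := div_neg_of_neg_of_pos (by linarith) hA
  refine ⟨fun z => ?_, ?_, ?_, fun z hz => ?_, ?_, ?_⟩
  · rw [hdd0, mul_comm]
  · simp [hy0]
  · simp [hd0]
  · have hp := (hpos z hz).ne'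
    have hprod : (A * z ^ 2 / 2 + B * z) * (1 - B / A * (A / (A * z + 2 * B))) =
        z * (A * z + B) / 2 := by
      rw [div_mul_div_cancel₀ hA.ne', one_sub_div hp, mul_div_assoc', div_eq_iff hp]
      ring
    rw [hdd1 z hz, hdd0, hd0, hy0]
    linear_combination (-2 * (A + B)) * hprod
  · simp [hy1]
  · simp [hd1 0 hzero]
end
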